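/- Let H in (0,1) with H != 1/2, T > 0, n >= 2 an integer, grid t_i = i*T/n, and G_H(s,t) := s^{2H} + t^{2H} - (1/2)[(s+t)^{2H} + |s-t|^{2H}]. For 1 <= j, k <= n-1 with |j-k| >= 1, the double second difference \hat d^{S^H,n}_{jk} := sum_{a=-1}^{1} sum_{b=-1}^{1} w_a w_b G_H(t_{j+a}, t_{k+b}) (weights w_{-1} = w_1 = 1, w_0 = -2) satisfies |\hat d^{S^H,n}_{jk}| <= 2 |rho_H(j-k)| (T/n)^{2H}, where rho_H(r) := (1/2)( -|r-2|^{2H} + 4|r-1|^{2H} - 6|r|^{2H} + 4|r+1|^{2H} - |r+2|^{2H} ). -/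

import Mathlib

/-- Iterated forward differences of a power differentiate termwise. -/
lemma hasDerivAt_fwdDiff_iter_rpow (m : ℕ) (q : ℝ) {x : ℝ} (hx : 0 < x) :
    HasDerivAt ((fwdDiff (1 : ℝ))^[m] fun y : ℝ ↦ y ^ q)
      (q * ((fwdDiff (1 : ℝ))^[m] fun y : ℝ ↦ y ^ (q - 1)) x) x := by
  induction m generalizing x with
  | zero => simpa using Real.hasDerivAt_rpow_const (p := q) (Or.inl hx.ne')
  | succ m ih =>
    rw [Function.iterate_succ_apply', Function.iterate_succ_apply']
    simp only [fwdDiff, mul_sub]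
    exact ((ih (by linarith)).comp_add_const x 1).sub (ih hx)

lemma continuous_fwdDiff_iter_rpow (m : ℕ) {q : ℝ} (hq : 0 ≤ q) :
    Continuous ((fwdDiff (1 : ℝ))^[m] fun y : ℝ ↦ y ^ q) := by
  induction m with
  | zero => simpa using Real.continuous_rpow_const hq
  | succ m ih =>
    rw [Function.iterate_succ_apply']
    exact (ih.comp (continuous_id.add continuous_const)).sub ih

lemma exists_fwdDiff_iter_succ_rpow_eq (m : ℕ) (q : ℝ) {x : ℝ} (hx : 0 ≤ x)
    (hc : ContinuousOn ((fwdDiff (1 : ℝ))^[m] fun y : ℝ ↦ y ^ q) (Set.Icc x (x + 1))) :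
    ∃ ξ : ℝ, 0 < ξ ∧ ((fwdDiff (1 : ℝ))^[m + 1] fun y : ℝ ↦ y ^ q) x
      = q * ((fwdDiff (1 : ℝ))^[m] fun y : ℝ ↦ y ^ (q - 1)) ξ := by
  obtain ⟨ξ, hξ, h⟩ := exists_hasDerivAt_eq_slope _ _ (by linarith : x < x + 1) hc
    fun y hy ↦ hasDerivAt_fwdDiff_iter_rpow m q (hx.trans_lt hy.1)
  refine ⟨ξ, hx.trans_lt hξ.1, ?_⟩
  rw [h, Function.iterate_succ_apply', fwdDiff]
  simp

/-- Mean value theorem for iterated forward differences of a power. -/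
lemma exists_fwdDiff_iter_rpow_eq (m : ℕ) (q : ℝ) {x : ℝ} (hx : 0 < x) :
    ∃ ζ : ℝ, 0 < ζ ∧ ((fwdDiff (1 : ℝ))^[m] fun y : ℝ ↦ y ^ q) x
      = (∏ i ∈ Finset.range m, (q - i)) * ζ ^ (q - m) := by
  induction m generalizing q x with
  | zero => exact ⟨x, hx, by simp⟩
  | succ m ih =>
    obtain ⟨ξ, hξ, h⟩ := exists_fwdDiff_iter_succ_rpow_eq m q hx.le fun y hy ↦
      (hasDerivAt_fwdDiff_iter_rpow m q (hx.trans_le hy.1)).continuousAt.continuousWithinAt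
    obtain ⟨ζ, hζ, h'⟩ := ih (q - 1) hξ
    refine ⟨ζ, hζ, ?_⟩
    rw [h, h', Finset.prod_range_succ', ← mul_assoc, mul_comm q]
    push_cast
    simp only [sub_zero, sub_sub, add_comm]

lemma exists_fwdDiff_iter_succ_rpow_eq_of_nonneg (m : ℕ) {q : ℝ} (hq : 0 < q) {x : ℝ}
    (hx : 0 ≤ x) :
    ∃ ζ : ℝ, 0 < ζ ∧ ((fwdDiff (1 : ℝ))^[m + 1] fun y : ℝ ↦ y ^ q) x
      = (∏ i ∈ Finset.range (m + 1), (q - i)) * ζ ^ (q - (m + 1 : ℕ)) := by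
  obtain ⟨ξ, hξ, h⟩ := exists_fwdDiff_iter_succ_rpow_eq m q hx
    (continuous_fwdDiff_iter_rpow m hq.le).continuousOn
  obtain ⟨ζ, hζ, h'⟩ := exists_fwdDiff_iter_rpow_eq m (q - 1) hξ
  refine ⟨ζ, hζ, ?_⟩
  rw [h, h', Finset.prod_range_succ', ← mul_assoc, mul_comm q]
  push_cast
  simp only [sub_zero, sub_sub, add_comm]

lemma rpow_thirdDiff_nonpos {p x : ℝ} (hp1 : 1 ≤ p) (hp2 : p ≤ 2) (hx : 0 ≤ x) :
    (x + 3) ^ p - 3 * (x + 2) ^ p + 3 * (x + 1) ^ p - x ^ p ≤ 0 := by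
  obtain ⟨ζ, hζ, h⟩ :=
    exists_fwdDiff_iter_succ_rpow_eq_of_nonneg 2 (by linarith : 0 < p) hx
  have e : (x + 3) ^ p - 3 * (x + 2) ^ p + 3 * (x + 1) ^ p - x ^ p
      = ((fwdDiff (1 : ℝ))^[2 + 1] fun y : ℝ ↦ y ^ p) x := by
    rw [fwdDiff_iter_eq_sum_shift]
    simp [Finset.sum_range_succ, Nat.choose]
    ring
  rw [e, h]
  refine mul_nonpos_of_nonpos_of_nonneg ?_ (Real.rpow_nonneg hζ.le _)
  simp only [Finset.prod_range_succ, Finset.prod_range_zero]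
  push_cast
  have : 0 ≤ p * (p - 1) := mul_nonneg (by linarith) (by linarith)
  nlinarith

/-- The fourth central difference of `|x| ^ p`. -/
noncomputable def absRpowFourthDiff (p x : ℝ) : ℝ :=
  |x - 2| ^ p - 4 * |x - 1| ^ p + 6 * |x| ^ p - 4 * |x + 1| ^ p + |x + 2| ^ p

lemma absRpowFourthDiff_neg (p x : ℝ) : absRpowFourthDiff p (-x) = absRpowFourthDiff p x := by
  have h1 : |-x - 2| = |x + 2| := by rw [← abs_neg]; ring_nf
  have h2 : |-x - 1| = |x + 1| := by rw [← abs_neg]; ring_nf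
  have h3 : |-x + 1| = |x - 1| := by rw [← abs_neg]; ring_nf
  have h4 : |-x + 2| = |x - 2| := by rw [← abs_neg]; ring_nf
  simp only [absRpowFourthDiff, h1, h2, h3, h4, abs_neg]
  ring

lemma absRpowFourthDiff_eq_fwdDiff (p : ℝ) {x : ℝ} (hx : 0 ≤ x) :
    absRpowFourthDiff p (x + 2) = ((fwdDiff (1 : ℝ))^[4] fun y : ℝ ↦ y ^ p) x := by
  rw [fwdDiff_iter_eq_sum_shift]
  simp only [absRpowFourthDiff]
  rw [abs_of_nonneg (by linarith), abs_of_nonneg (by linarith), abs_of_nonneg (by linarith),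
    abs_of_nonneg (by linarith), abs_of_nonneg (by linarith)]
  simp [Finset.sum_range_succ, Nat.choose]
  ring_nf

lemma exists_absRpowFourthDiff_eq {p : ℝ} (hp : 0 < p) {x : ℝ} (hx : 0 ≤ x) :
    ∃ c : ℝ, 0 ≤ c ∧
      absRpowFourthDiff p (x + 2) = p * (p - 1) * (p - 2) * (p - 3) * c := by
  obtain ⟨ζ, hζ, h⟩ := exists_fwdDiff_iter_succ_rpow_eq_of_nonneg 3 hp hx
  refine ⟨_, Real.rpow_nonneg hζ.le (p - (3 + 1 : ℕ)),
    (absRpowFourthDiff_eq_fwdDiff p hx).trans (h.trans ?_)⟩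
  simp [Finset.prod_range_succ]

lemma exists_absRpowFourthDiff_succ_sub_eq {p : ℝ} (hp : 0 < p) {x : ℝ} (hx : 0 ≤ x) :
    ∃ c : ℝ, 0 ≤ c ∧ absRpowFourthDiff p (x + 1 + 2) - absRpowFourthDiff p (x + 2)
      = p * (p - 1) * (p - 2) * (p - 3) * (p - 4) * c := by
  obtain ⟨ζ, hζ, h⟩ := exists_fwdDiff_iter_succ_rpow_eq_of_nonneg 4 hp hx
  refine ⟨_, Real.rpow_nonneg hζ.le (p - (4 + 1 : ℕ)), ?_⟩
  rw [absRpowFourthDiff_eq_fwdDiff p hx, absRpowFourthDiff_eq_fwdDiff p (by linarith)]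
  rw [Function.iterate_succ_apply', fwdDiff] at h
  rw [h]
  simp [Finset.prod_range_succ]

lemma absRpowFourthDiff_nonneg {p : ℝ} (hp1 : 1 ≤ p) (hp2 : p ≤ 2) {x : ℝ} (hx : 0 ≤ x) :
    0 ≤ absRpowFourthDiff p (x + 2) := by
  obtain ⟨c, hc, h⟩ := exists_absRpowFourthDiff_eq (by linarith : 0 < p) hx
  rw [h]
  exact mul_nonneg (mul_nonneg_of_nonpos_of_nonpos (mul_nonpos_of_nonneg_of_nonpos
    (mul_nonneg (by linarith) (by linarith)) (by linarith)) (by linarith)) hc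

lemma abs_absRpowFourthDiff_succ_le {p : ℝ} (hp : 0 < p) (hp2 : p < 2) {x : ℝ} (hx : 0 ≤ x) :
    |absRpowFourthDiff p (x + 1 + 2)| ≤ |absRpowFourthDiff p (x + 2)| := by
  obtain ⟨a, ha, h1⟩ := exists_absRpowFourthDiff_eq hp hx
  obtain ⟨b, hb, h2⟩ := exists_absRpowFourthDiff_eq hp (by linarith : 0 ≤ x + 1)
  obtain ⟨c, hc, h3⟩ := exists_absRpowFourthDiff_succ_sub_eq hp hx
  rw [h1, h2] at h3 ⊢
  generalize p * (p - 1) * (p - 2) * (p - 3) = C at h3 ⊢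
  rw [abs_mul C, abs_mul C]
  rcases eq_or_ne C 0 with hC | hC
  · simp [hC]
  · have : b - a = (p - 4) * c := mul_left_cancel₀ hC (by linarith)
    have : (p - 4) * c ≤ 0 := mul_nonpos_of_nonpos_of_nonneg (by linarith) hc
    rw [abs_of_nonneg ha, abs_of_nonneg hb]
    gcongr
    linarith

lemma antitone_abs_absRpowFourthDiff {p : ℝ} (hp : 0 < p) (hp2 : p < 2) :
    Antitone fun m : ℕ ↦ |absRpowFourthDiff p ((m : ℝ) + 2)| := by
  refine antitone_nat_of_succ_le fun m ↦ ?_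
  push_cast
  exact abs_absRpowFourthDiff_succ_le hp hp2 m.cast_nonneg

lemma absRpowFourthDiff_one {p : ℝ} (hp : 0 < p) :
    absRpowFourthDiff p 1 = 7 - 4 * 2 ^ p + 3 ^ p := by
  norm_num [absRpowFourthDiff, Real.zero_rpow hp.ne']

lemma four_rpow_eq (p : ℝ) : (4 : ℝ) ^ p = 2 ^ p * 2 ^ p := by
  rw [← Real.mul_rpow (by norm_num) (by norm_num)]
  norm_num

lemma abs_absRpowFourthDiff_three_le {p : ℝ} (hp : 0 < p) (hp2 : p < 2) :
    |absRpowFourthDiff p 3| ≤ |absRpowFourthDiff p 1| := by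
  have h4 := four_rpow_eq p
  have h2 : absRpowFourthDiff p 2 = -4 + 6 * 2 ^ p - 4 * 3 ^ p + 4 ^ p := by
    norm_num [absRpowFourthDiff, Real.zero_rpow hp.ne']
  refine le_trans ?_ (le_abs_self _)
  rw [absRpowFourthDiff_one hp]
  rcases le_total p 1 with hp1 | hp1
  · have h32 := antitone_abs_absRpowFourthDiff hp hp2 (zero_le_one)
    norm_num at h32
    refine h32.trans ?_
    obtain ⟨c, hc, h⟩ := exists_absRpowFourthDiff_eq hp le_rfl
    have hneg : absRpowFourthDiff p 2 ≤ 0 := by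
      rw [zero_add] at h
      rw [h]
      refine mul_nonpos_of_nonpos_of_nonneg (mul_nonpos_of_nonneg_of_nonpos
        (mul_nonneg_of_nonpos_of_nonpos (mul_nonpos_of_nonneg_of_nonpos hp.le
        (by linarith)) (by linarith)) (by linarith)) hc
    have hconc := (Real.concaveOn_rpow hp.le hp1).2 (show (1 : ℝ) ∈ Set.Ici 0 by simp)
      (show (3 : ℝ) ∈ Set.Ici 0 by simp) (show (0 : ℝ) ≤ 1 / 2 by norm_num)
      (show (0 : ℝ) ≤ 1 / 2 by norm_num) (by norm_num)
    norm_num at hconc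
    rw [abs_of_nonpos hneg, h2, h4]
    nlinarith [sq_nonneg ((2 : ℝ) ^ p - 2)]
  · have h3 := absRpowFourthDiff_nonneg hp1 hp2.le (zero_le_one)
    norm_num at h3
    rw [abs_of_nonneg h3]
    have e3 : absRpowFourthDiff p 3 = 1 - 4 * 2 ^ p + 6 * 3 ^ p - 4 * 4 ^ p + 5 ^ p := by
      norm_num [absRpowFourthDiff]
    have hfour := absRpowFourthDiff_nonneg hp1 hp2.le le_rfl
    have hthree := rpow_thirdDiff_nonpos hp1 hp2.le (zero_le_two)
    norm_num at hfour hthree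
    rw [h2] at hfour
    rw [e3]
    nlinarith [sq_nonneg ((2 : ℝ) ^ p - 4)]

lemma abs_absRpowFourthDiff_le {p : ℝ} (hp : 0 < p) (hp2 : p < 2) {r m : ℤ} (hr : 1 ≤ |r|)
    (hrm : |r| + 2 ≤ m) : |absRpowFourthDiff p m| ≤ |absRpowFourthDiff p r| := by
  wlog h0 : 0 ≤ r generalizing r
  · have := this (r := -r) (by simpa using hr) (by simpa using hrm) (by omega)
    rwa [Int.cast_neg, absRpowFourthDiff_neg] at this
  rw [abs_of_nonneg h0] at hr hrm
  have key : ∀ a b : ℤ, 2 ≤ a → a ≤ b →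
      |absRpowFourthDiff p b| ≤ |absRpowFourthDiff p a| := by
    intro a b ha hab
    obtain ⟨a', rfl⟩ : ∃ a' : ℕ, a = a' + 2 := ⟨(a - 2).toNat, by omega⟩
    obtain ⟨b', rfl⟩ : ∃ b' : ℕ, b = b' + 2 := ⟨(b - 2).toNat, by omega⟩
    have := antitone_abs_absRpowFourthDiff hp hp2 (by omega : a' ≤ b')
    simpa using this
  rcases hr.eq_or_lt with rfl | hr
  · have h3 := key 3 m (by norm_num) (by omega)
    push_cast at h3 ⊢
    exact h3.trans (abs_absRpowFourthDiff_three_le hp hp2)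
  · exact key r m (by omega) (by omega)

/-- Off-diagonal bound `|d̂^{S^H,n}_{jk}| ≤ 2 |ρ_H(j-k)| (T/n)^{2H}` for
sub-fractional Brownian motion. -/
theorem stmt_10 (H : ℝ) (hH : H ∈ Set.Ioo (0 : ℝ) 1) (hH2 : H ≠ 1 / 2)
    (T : ℝ) (hT : 0 < T) (n : ℕ) (hn : 2 ≤ n)
    (t : ℤ → ℝ) (ht : ∀ i, t i = (i : ℝ) * T / n)
    (G : ℝ → ℝ → ℝ)
    (hG : ∀ s u, G s u = s ^ (2 * H) + u ^ (2 * H)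
      - (1 / 2) * ((s + u) ^ (2 * H) + |s - u| ^ (2 * H)))
    (w : ℤ → ℝ) (hwm : w (-1) = 1) (hw0 : w 0 = -2) (hw1 : w 1 = 1)
    (ρ : ℤ → ℝ)
    (hρ : ∀ r : ℤ, ρ r = (1 / 2) * (-|(r : ℝ) - 2| ^ (2 * H) + 4 * |(r : ℝ) - 1| ^ (2 * H)
      - 6 * |(r : ℝ)| ^ (2 * H) + 4 * |(r : ℝ) + 1| ^ (2 * H) - |(r : ℝ) + 2| ^ (2 * H)))
    (j k : ℤ) (hj1 : 1 ≤ j) (hj2 : j ≤ (n : ℤ) - 1) (hk1 : 1 ≤ k) (hk2 : k ≤ (n : ℤ) - 1)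
    (hjk : 1 ≤ |j - k|) :
    |∑ a ∈ Finset.Icc (-1 : ℤ) 1, ∑ b ∈ Finset.Icc (-1 : ℤ) 1,
        w a * w b * G (t (j + a)) (t (k + b))|
      ≤ 2 * |ρ (j - k)| * (T / n) ^ (2 * H) := by
  obtain ⟨hH0, hH1⟩ := hH
  set p := 2 * H with hp
  set h := T / n with hh
  have hh0 : 0 ≤ h := by positivity
  set B : ℤ → ℝ := fun m ↦ h ^ p * |(m : ℝ)| ^ p with hB
  have hGB : ∀ a b : ℤ, 0 ≤ a → 0 ≤ b →
      G (t a) (t b) = B a + B b - 1 / 2 * (B (a + b) + B (a - b)) := by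
    intro a b ha hb
    have ha' : (0 : ℝ) ≤ a := by exact_mod_cast ha
    have hb' : (0 : ℝ) ≤ b := by exact_mod_cast hb
    have e : ∀ i, t i = h * i := fun i ↦ by rw [ht, hh]; ring
    simp only [hG, e, hB]
    rw [← mul_add, ← mul_sub, abs_mul, abs_of_nonneg hh0]
    push_cast
    rw [Real.mul_rpow hh0 ha', Real.mul_rpow hh0 hb', Real.mul_rpow hh0 (add_nonneg ha' hb'),
      Real.mul_rpow hh0 (abs_nonneg _), abs_of_nonneg ha', abs_of_nonneg hb',
      abs_of_nonneg (add_nonneg ha' hb')]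
  have hfour : ∀ m : ℤ, B (m - 2) - 4 * B (m - 1) + 6 * B m - 4 * B (m + 1) + B (m + 2)
      = h ^ p * absRpowFourthDiff p m := by
    intro m
    simp only [hB, absRpowFourthDiff]
    push_cast
    ring
  have hI : Finset.Icc (-1 : ℤ) 1 = {-1, 0, 1} := rfl
  have hsum : ∑ a ∈ Finset.Icc (-1 : ℤ) 1, ∑ b ∈ Finset.Icc (-1 : ℤ) 1,
        w a * w b * G (t (j + a)) (t (k + b))
      = -(1 / 2) * (h ^ p * absRpowFourthDiff p (j + k : ℤ)
        + h ^ p * absRpowFourthDiff p (j - k : ℤ)) := by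
    rw [← hfour, ← hfour, hI]
    clear_value B
    simp only [Finset.sum_insert (by decide : (-1 : ℤ) ∉ ({0, 1} : Finset ℤ)),
      Finset.sum_insert (by decide : (0 : ℤ) ∉ ({1} : Finset ℤ)), Finset.sum_singleton,
      hwm, hw0, hw1]
    rw [hGB _ _ (by omega) (by omega), hGB _ _ (by omega) (by omega),
      hGB _ _ (by omega) (by omega), hGB _ _ (by omega) (by omega),
      hGB _ _ (by omega) (by omega), hGB _ _ (by omega) (by omega),
      hGB _ _ (by omega) (by omega), hGB _ _ (by omega) (by omega),
      hGB _ _ (by omega) (by omega)]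
    ring_nf
  have hρ' : ρ (j - k) = -(1 / 2) * absRpowFourthDiff p (j - k : ℤ) := by
    rw [hρ, absRpowFourthDiff]
    ring
  have hle := abs_absRpowFourthDiff_le (by linarith : 0 < p) (by linarith : p < 2) hjk
    (m := j + k) (by rcases abs_cases (j - k) with h | h <;> omega)
  have hhp : 0 ≤ h ^ p := Real.rpow_nonneg hh0 _
  rw [hsum, hρ', ← mul_add, abs_mul, abs_mul, abs_mul, abs_of_nonneg hhp]
  norm_num only [abs_neg, abs_div, abs_one, abs_two]
  have htri := abs_add_le (absRpowFourthDiff p (j + k : ℤ)) (absRpowFourthDiff p (j - k : ℤ))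
  nlinarith [mul_le_mul_of_nonneg_left (htri.trans (add_le_add_left hle _)) hhp]
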